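/- Let x = (x₁,x₂,x₃) : 𝔻 → ℂ³ be an analytic map with x(𝔻) ⊆ Ē. Then there exist a complex Hilbert space H and bounded linear operators A : H → H, B₁, B₂ : ℂ → H, C₁, C₂ : H → ℂ and complex numbers D₁₁, D₁₂, D₂₁, D₂₂ such that the block operator [[A, B],[C, D]] : H ⊕ ℂ² → H ⊕ ℂ² is unitary, where B = [B₁ B₂] : ℂ² → H, C = [C₁; C₂] : H → ℂ² and D = [D_{ij}] : ℂ² → ℂ², and such that for every λ ∈ 𝔻 the operator 1 − λA is invertible and x₁(λ) = D₁₁ + λ C₁(1 − λA)⁻¹B₁, x₂(λ) = D₂₂ + λ C₂(1 − λA)⁻¹B₂, and x₃(λ) = det( D + λ C (1 − λA)⁻¹ B ). -/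

import Mathlib

/-- The closed tetrablock. -/
def closedTetra : Set (ℂ × ℂ × ℂ) :=
  {x | ∀ z ∈ Metric.ball (0:ℂ) 1, ∀ w ∈ Metric.ball (0:ℂ) 1,
        1 - x.1 * z - x.2.1 * w + x.2.2 * z * w ≠ 0}

section

open ContinuousLinearMap ComplexConjugate Metric Filter Topology
open scoped InnerProductSpace Matrix

/-- Two isometries `a, b : E → K` are intertwined by a unitary of `K ⊕ K` (a Halmos dilation
of `b a*`). -/
theorem exists_halmos_unitary {E K : Type*} [NormedAddCommGroup E] [InnerProductSpace ℂ E]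
    [CompleteSpace E] [NormedAddCommGroup K] [InnerProductSpace ℂ K] [CompleteSpace K]
    (a b : E →ₗᵢ[ℂ] K) :
    ∃ U : WithLp 2 (K × K) ≃ₗᵢ[ℂ] WithLp 2 (K × K),
      ∀ e, U (WithLp.toLp 2 (a e, 0)) = WithLp.toLp 2 (b e, 0) := by
  set a' : K →L[ℂ] E := adjoint a.toContinuousLinearMap with ha'
  set b' : K →L[ℂ] E := adjoint b.toContinuousLinearMap with hb'
  have haa : ∀ e, a' (a e) = e := fun e ↦ ext_inner_right ℂ fun v ↦ by
    rw [ha', adjoint_inner_left]; exact a.inner_map_map e v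
  have hbb : ∀ e, b' (b e) = e := fun e ↦ ext_inner_right ℂ fun v ↦ by
    rw [hb', adjoint_inner_left]; exact b.inner_map_map e v
  have pyth : ∀ (c : E →ₗᵢ[ℂ] K) (c' : K →L[ℂ] E), c' = adjoint c.toContinuousLinearMap →
      ∀ (e : E) (y : K), ‖c e + (y - c (c' y))‖ ^ 2 = ‖e‖ ^ 2 + (‖y‖ ^ 2 - ‖c' y‖ ^ 2) := by
    intro c c' hc e y
    have horth : ∀ e, ⟪c e, y - c (c' y)⟫_ℂ = 0 := fun e ↦ by
      have h : ⟪c e, y⟫_ℂ = ⟪e, c' y⟫_ℂ := by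
        rw [hc, adjoint_inner_right]; rfl
      rw [inner_sub_right, c.inner_map_map, h, sub_self]
    have h₁ := norm_add_sq_eq_norm_sq_add_norm_sq_of_inner_eq_zero _ _ (horth e)
    have h₂ := norm_add_sq_eq_norm_sq_add_norm_sq_of_inner_eq_zero _ _ (horth (c' y))
    rw [add_sub_cancel] at h₂
    simp only [c.norm_map, ← pow_two] at h₁ h₂
    linarith
  let f : WithLp 2 (K × K) →ₗ[ℂ] WithLp 2 (K × K) :=
    { toFun := fun p ↦ WithLp.toLp 2
        (b (a' p.fst) + (p.snd - b (b' p.snd)), (p.fst - a (a' p.fst)) - a (b' p.snd))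
      map_add' := fun p q ↦ by
        simp only [WithLp.add_fst, WithLp.add_snd, map_add, ← WithLp.toLp_add, Prod.mk_add_mk]
        congr 2 <;> abel
      map_smul' := fun c p ↦ by
        simp [← WithLp.toLp_smul, smul_sub] }
  let g : WithLp 2 (K × K) →ₗ[ℂ] WithLp 2 (K × K) :=
    { toFun := fun p ↦ WithLp.toLp 2
        (a (b' p.fst) + (p.snd - a (a' p.snd)), (p.fst - b (b' p.fst)) - b (a' p.snd))
      map_add' := fun p q ↦ by
        simp only [WithLp.add_fst, WithLp.add_snd, map_add, ← WithLp.toLp_add, Prod.mk_add_mk]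
        congr 2 <;> abel
      map_smul' := fun c p ↦ by
        simp [← WithLp.toLp_smul, smul_sub] }
  refine ⟨⟨LinearEquiv.ofLinearMap f g ?_ ?_, ?_⟩, ?_⟩
  · refine LinearMap.ext fun p ↦ ?_
    refine WithLp.ofLp_injective 2 (Prod.ext ?_ ?_) <;> simp [f, g, haa, hbb]
  · refine LinearMap.ext fun p ↦ ?_
    refine WithLp.ofLp_injective 2 (Prod.ext ?_ ?_) <;> simp [f, g, haa, hbb]
  · intro p
    have h : ‖f p‖ ^ 2 = ‖p‖ ^ 2 := by
      rw [WithLp.prod_norm_sq_eq_of_L2, WithLp.prod_norm_sq_eq_of_L2]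
      have h₁ := pyth b b' hb' (a' p.fst) p.snd
      have h₂ := pyth a a' ha' (-(b' p.snd)) p.fst
      rw [map_neg, neg_add_eq_sub, norm_neg] at h₂
      exact (congrArg₂ (· + ·) h₁ h₂).trans (by ring)
    exact (sq_eq_sq₀ (norm_nonneg _) (norm_nonneg _)).1 h
  · intro e
    change f _ = _
    simp [f, haa]

/-- Families with the same Gram matrix are unitarily equivalent after doubling the space. -/
theorem exists_unitary_of_inner_eq {ι K : Type*} [NormedAddCommGroup K] [InnerProductSpace ℂ K]
    [CompleteSpace K] (p q : ι → K) (h : ∀ i j, ⟪p i, p j⟫_ℂ = ⟪q i, q j⟫_ℂ) :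
    ∃ U : WithLp 2 (K × K) ≃ₗᵢ[ℂ] WithLp 2 (K × K),
      ∀ i, U (WithLp.toLp 2 (p i, 0)) = WithLp.toLp 2 (q i, 0) := by
  set α := Finsupp.linearCombination ℂ p
  set β := Finsupp.linearCombination ℂ q
  have hnorm : ∀ c, ‖β c‖ = ‖α c‖ := fun c ↦ by
    rw [@norm_eq_sqrt_re_inner ℂ, @norm_eq_sqrt_re_inner ℂ]
    simp only [α, β, Finsupp.linearCombination_apply, Finsupp.sum_inner,
      Finsupp.inner_sum, inner_smul_left, inner_smul_right, h]
  let E := (LinearMap.range α).topologicalClosure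
  let α' : (ι →₀ ℂ) →ₗ[ℂ] E :=
    α.codRestrict E fun c ↦ Submodule.le_topologicalClosure _ (LinearMap.mem_range_self α c)
  have hdense : DenseRange α' := by
    intro y
    rw [Metric.mem_closure_iff]
    intro ε hε
    obtain ⟨_, ⟨c, rfl⟩, hc⟩ := Metric.mem_closure_iff.1 (show (y : K) ∈ closure _ from y.2) ε hε
    exact ⟨α' c, ⟨c, rfl⟩, hc⟩
  have hbound : ∀ c, ‖β c‖ ≤ 1 * ‖α' c‖ := fun c ↦ by
    rw [one_mul, hnorm]; rfl
  have hext : ∀ c, β.extendOfNorm α' (α' c) = β c :=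
    LinearMap.extendOfNorm_eq hdense ⟨1, hbound⟩
  have hiso : ∀ y, ‖β.extendOfNorm α' y‖ = ‖y‖ := fun y ↦ by
    refine hdense.induction_on (p := fun y ↦ ‖β.extendOfNorm α' y‖ = ‖y‖) y
      (isClosed_eq (by fun_prop) (by fun_prop)) fun c ↦ ?_
    rw [hext, hnorm]; rfl
  have : CompleteSpace E := (Submodule.isClosed_topologicalClosure _).completeSpace_coe
  obtain ⟨U, hU⟩ := exists_halmos_unitary E.subtypeₗᵢ ⟨(β.extendOfNorm α').toLinearMap, hiso⟩
  refine ⟨U, fun i ↦ ?_⟩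
  have h₁ : E.subtypeₗᵢ (α' (Finsupp.single i 1)) = p i := by
    change α (Finsupp.single i 1) = p i
    simp [α]
  have h₂ : β.extendOfNorm α' (α' (Finsupp.single i 1)) = q i := by
    rw [hext]; simp [β]
  rw [← h₁, hU, ← h₂]
  rfl

/-- Exchanging the last two summands of `H ⊕ K ⊕ V`. -/
noncomputable def prodRightComm (H K V : Type*) [NormedAddCommGroup H] [InnerProductSpace ℂ H]
    [NormedAddCommGroup K] [InnerProductSpace ℂ K] [NormedAddCommGroup V]
    [InnerProductSpace ℂ V] :
    WithLp 2 (WithLp 2 (H × K) × V) ≃ₗᵢ[ℂ] WithLp 2 (WithLp 2 (H × V) × K) where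
  toFun p := WithLp.toLp 2 (WithLp.toLp 2 (p.fst.fst, p.snd), p.fst.snd)
  invFun p := WithLp.toLp 2 (WithLp.toLp 2 (p.fst.fst, p.snd), p.fst.snd)
  map_add' _ _ := rfl
  map_smul' _ _ := rfl
  left_inv _ := rfl
  right_inv _ := rfl
  norm_map' p := by
    refine (sq_eq_sq₀ (norm_nonneg _) (norm_nonneg _)).1 ?_
    change ‖WithLp.toLp 2 (WithLp.toLp 2 (p.fst.fst, p.snd), p.fst.snd)‖ ^ 2 = _
    simp only [WithLp.prod_norm_sq_eq_of_L2, WithLp.toLp_fst, WithLp.toLp_snd]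
    ring

/-- The de Branges–Rovnyak kernel `(1 - F(x)* F(y)) / (1 - x̄ y)` on the unit disc. -/
noncomputable def pickKernel {V : Type*} [NormedAddCommGroup V] [InnerProductSpace ℂ V]
    [CompleteSpace V] (F : ℂ → V →L[ℂ] V) :
    Matrix (Metric.ball (0 : ℂ) 1) (Metric.ball (0 : ℂ) 1) (V →L[ℂ] V) :=
  .of fun x y ↦ (1 - conj (x : ℂ) * y)⁻¹ • (1 - adjoint (F x) ∘L F y)

theorem inner_pickKernel {V : Type*} [NormedAddCommGroup V] [InnerProductSpace ℂ V]
    [CompleteSpace V] (F : ℂ → V →L[ℂ] V) (x y : Metric.ball (0 : ℂ) 1) (v w : V) :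
    ⟪pickKernel F x y v, w⟫_ℂ =
      (1 - conj (y : ℂ) * x)⁻¹ * (⟪v, w⟫_ℂ - ⟪F y v, F x w⟫_ℂ) := by
  simp [pickKernel, adjoint_inner_left, mul_comm]

theorem one_sub_conj_mul_ne_zero {z w : ℂ} (hz : ‖z‖ < 1) (hw : ‖w‖ ≤ 1) :
    1 - conj z * w ≠ 0 := by
  intro h
  have h₁ : ‖conj z * w‖ = 1 := by rw [← sub_eq_zero.1 h, norm_one]
  rw [norm_mul, RCLike.norm_conj] at h₁
  nlinarith [norm_nonneg z, norm_nonneg w]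

open scoped ComplexOrder in
/-- The lurking isometry: a positive semidefinite kernel yields a unitary colligation. -/
theorem exists_colligation {V : Type} [NormedAddCommGroup V] [InnerProductSpace ℂ V]
    [CompleteSpace V] (F : ℂ → V →L[ℂ] V) (hF : (pickKernel F).PosSemidef) :
    ∃ (H : Type) (_ : NormedAddCommGroup H) (_ : InnerProductSpace ℂ H) (_ : CompleteSpace H)
      (U : WithLp 2 (H × V) ≃ₗᵢ[ℂ] WithLp 2 (H × V)),
      ∀ z ∈ Metric.ball (0 : ℂ) 1, ∀ v, ∃ h : H,
        U (WithLp.toLp 2 (z • h, v)) = WithLp.toLp 2 (h, F z v) := by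
  have : Fact (pickKernel F).PosSemidef := ⟨hF⟩
  let H₀ := RKHS.OfKernel (pickKernel F)
  let G : Metric.ball (0 : ℂ) 1 → V →L[ℂ] H₀ := RKHS.kerFun H₀
  have hG : ∀ x y v w, ⟪G x v, G y w⟫_ℂ =
      (1 - conj (x : ℂ) * y)⁻¹ * (⟪v, w⟫_ℂ - ⟪F x v, F y w⟫_ℂ) := fun x y v w ↦ by
    rw [← inner_pickKernel, ← RKHS.kernel_inner, RKHS.OfKernel.kernel_ofKernel]
  let K := WithLp 2 (H₀ × V)
  obtain ⟨U, hU⟩ := exists_unitary_of_inner_eq (ι := Metric.ball (0 : ℂ) 1 × V) (K := K)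
    (fun i ↦ WithLp.toLp 2 ((i.1 : ℂ) • G i.1 i.2, i.2))
    (fun i ↦ WithLp.toLp 2 (G i.1 i.2, F i.1 i.2)) fun ⟨x, v⟩ ⟨y, w⟩ ↦ by
      have hne : 1 - conj (x : ℂ) * y ≠ 0 :=
        one_sub_conj_mul_ne_zero (mem_ball_zero_iff.1 x.2) (mem_ball_zero_iff.1 y.2).le
      change ⟪(x : ℂ) • G x v, (y : ℂ) • G y w⟫_ℂ + ⟪v, w⟫_ℂ =
        ⟪G x v, G y w⟫_ℂ + ⟪F x v, F y w⟫_ℂ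
      simp only [inner_smul_left, inner_smul_right, hG]
      linear_combination (⟪F x v, F y w⟫_ℂ - ⟪v, w⟫_ℂ) * inv_mul_cancel₀ hne
  let e := prodRightComm H₀ K V
  refine ⟨WithLp 2 (H₀ × K), inferInstance, inferInstance, inferInstance,
    (e.trans U).trans e.symm, fun z hz v ↦ ⟨WithLp.toLp 2 (G ⟨z, hz⟩ v, 0), ?_⟩⟩
  have h := hU (⟨z, hz⟩, v)
  have h' : e (WithLp.toLp 2 (z • WithLp.toLp 2 (G ⟨z, hz⟩ v, (0 : K)), v)) =
      WithLp.toLp 2 (WithLp.toLp 2 (z • G ⟨z, hz⟩ v, v), 0) := by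
    rw [← WithLp.toLp_smul, Prod.smul_mk, smul_zero]; rfl
  rw [LinearIsometryEquiv.trans_apply, LinearIsometryEquiv.trans_apply, h']
  rw [h]
  rfl

theorem exists_blocks {H : Type} [NormedAddCommGroup H] [InnerProductSpace ℂ H] [CompleteSpace H]
    (F : ℂ → EuclideanSpace ℂ (Fin 2) →L[ℂ] EuclideanSpace ℂ (Fin 2))
    (U : WithLp 2 (H × EuclideanSpace ℂ (Fin 2)) ≃ₗᵢ[ℂ] WithLp 2 (H × EuclideanSpace ℂ (Fin 2)))
    (hU : ∀ z ∈ Metric.ball (0 : ℂ) 1, ∀ v, ∃ h : H,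
        U (WithLp.toLp 2 (z • h, v)) = WithLp.toLp 2 (h, F z v)) :
    ∃ (A : H →L[ℂ] H) (B : Fin 2 → ℂ →L[ℂ] H) (C : Fin 2 → H →L[ℂ] ℂ) (D : Fin 2 → Fin 2 → ℂ),
      (∀ (h : H) (u : EuclideanSpace ℂ (Fin 2)),
        U (WithLp.toLp 2 (h, u)) = WithLp.toLp 2 (A h + B 0 (u 0) + B 1 (u 1),
          WithLp.toLp 2 ![C 0 h + D 0 0 * u 0 + D 0 1 * u 1,
            C 1 h + D 1 0 * u 0 + D 1 1 * u 1])) ∧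
      ∀ l ∈ Metric.ball (0 : ℂ) 1, IsUnit (1 - l • A) ∧ ∀ i j,
        F l (EuclideanSpace.single j 1) i =
          D i j + l * C i (Ring.inverse (1 - l • A) (B j 1)) := by
  let e := WithLp.prodContinuousLinearEquiv 2 ℂ H (EuclideanSpace ℂ (Fin 2))
  let U' : H × EuclideanSpace ℂ (Fin 2) →L[ℂ] H × EuclideanSpace ℂ (Fin 2) :=
    e.toContinuousLinearMap ∘L (U.toContinuousLinearEquiv.toContinuousLinearMap ∘L
      e.symm.toContinuousLinearMap)
  have hU' : ∀ h u, U' (h, u) = WithLp.ofLp (U (WithLp.toLp 2 (h, u))) := fun _ _ ↦ rfl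
  let b : Fin 2 → EuclideanSpace ℂ (Fin 2) := fun j ↦ EuclideanSpace.single j 1
  let A : H →L[ℂ] H := fst ℂ _ _ ∘L U' ∘L inl ℂ _ _
  let B : Fin 2 → ℂ →L[ℂ] H := fun j ↦
    fst ℂ _ _ ∘L U' ∘L inr ℂ _ _ ∘L toSpanSingleton ℂ (b j)
  let C : Fin 2 → H →L[ℂ] ℂ := fun i ↦ EuclideanSpace.proj i ∘L snd ℂ _ _ ∘L U' ∘L inl ℂ _ _
  let D : Fin 2 → Fin 2 → ℂ := fun i j ↦ (U' (0, b j)).2 i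
  have hdec : ∀ h (u : EuclideanSpace ℂ (Fin 2)),
      U' (h, u) = U' (h, 0) + (u 0 • U' (0, b 0) + u 1 • U' (0, b 1)) := fun h u ↦ by
    rw [← map_smul, ← map_smul, ← map_add, ← map_add]
    congr 1
    refine Prod.ext (by simp) ?_
    ext i
    fin_cases i <;> simp [b]
  have hfst : ∀ h (u : EuclideanSpace ℂ (Fin 2)),
      (U' (h, u)).1 = A h + B 0 (u 0) + B 1 (u 1) := fun h u ↦ by
    have hB : ∀ j (c : ℂ), B j c = c • (U' (0, b j)).1 := fun j c ↦ by
      have h₁ : B j c = (U' (0, c • b j)).1 := rfl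
      have h₂ : ((0 : H), c • b j) = c • ((0 : H), b j) := by simp
      rw [h₁, h₂, map_smul, Prod.smul_fst]
    rw [hdec, hB, hB, add_assoc]
    rfl
  have hsnd : ∀ h (u : EuclideanSpace ℂ (Fin 2)) i,
      (U' (h, u)).2 i = C i h + D i 0 * u 0 + D i 1 * u 1 := fun h u i ↦ by
    rw [hdec, mul_comm (D i 0), mul_comm (D i 1), add_assoc]
    rfl
  refine ⟨A, B, C, D, fun h u ↦ ?_, fun l hl ↦ ?_⟩
  · refine WithLp.ofLp_injective 2 (Prod.ext (hfst h u) ?_)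
    ext i
    refine (hsnd h u i).trans ?_
    fin_cases i <;> rfl
  · have hA : ‖A‖ ≤ 1 := A.opNorm_le_bound zero_le_one fun h ↦ by
      rw [one_mul]
      calc ‖A h‖ ≤ ‖U (WithLp.toLp 2 (h, 0))‖ := WithLp.norm_fst_le _ _
        _ = ‖h‖ := by rw [U.norm_map, WithLp.norm_toLp_fst]
    have hunit : IsUnit (1 - l • A) := isUnit_one_sub_of_norm_lt_one <| by
      rw [norm_smul]
      have := mem_ball_zero_iff.1 hl
      nlinarith [norm_nonneg l, norm_nonneg A]
    refine ⟨hunit, fun i j ↦ ?_⟩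
    obtain ⟨h, hh⟩ := hU l hl (b j)
    have key : U' (l • h, b j) = (h, F l (b j)) := by rw [hU', hh]
    have hB : U' (0, b j) = (B j 1, (U' (0, b j)).2) := by
      refine Prod.ext ?_ rfl
      change _ = (U' (0, (1 : ℂ) • b j)).1
      rw [one_smul]
    have hsplit : U' (l • h, b j) = l • U' (h, 0) + U' (0, b j) := by
      rw [← map_smul, ← map_add]; simp
    have h₁ : h = l • A h + B j 1 := by
      have := congrArg Prod.fst (key.symm.trans hsplit)
      rw [hB] at this
      exact this
    have h₂ : F l (b j) i = l * C i h + D i j := by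
      have := congrArg (fun p ↦ p.2 i) (key.symm.trans hsplit)
      exact this
    have h₃ : Ring.inverse (1 - l • A) (B j 1) = h := by
      have h₄ : B j 1 = (1 - l • A) h := by
        rw [sub_apply, smul_apply, one_apply_eq_self]
        exact (sub_eq_of_eq_add' h₁).symm
      rw [h₄, ← mul_apply_eq_comp, Ring.inverse_mul_cancel _ hunit, one_apply_eq_self]
    rw [h₃, add_comm]
    exact h₂

theorem DiffContOnCl.re_sum_nonneg {κ : Type*} (t : Finset κ) {x : κ → ℂ}
    (hx : ∀ k, x k ∈ Metric.ball (0 : ℂ) 1) {h : κ → ℂ → ℂ}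
    (hh : ∀ k, DiffContOnCl ℂ (h k) (Metric.ball 0 1))
    (hpos : ∀ ζ ∈ Metric.sphere (0 : ℂ) 1, 0 ≤ (∑ k ∈ t, ζ / (ζ - x k) * h k ζ).re) :
    0 ≤ (∑ k ∈ t, h k (x k)).re := by
  have hint : ∀ k, CircleIntegrable (fun ζ ↦ ζ / (ζ - x k) * h k ζ) 0 1 := fun k ↦ by
    refine ContinuousOn.circleIntegrable zero_le_one (ContinuousOn.mul (ContinuousOn.div₀
      continuousOn_id (by fun_prop) fun ζ hζ h₀ ↦ ?_) ?_)
    · rw [sub_eq_zero.1 h₀] at hζ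
      exact Metric.sphere_disjoint_ball.le_bot ⟨hζ, hx k⟩
    · exact (closure_ball (0 : ℂ) one_ne_zero ▸ (hh k).continuousOn).mono
        Metric.sphere_subset_closedBall
  have havg : ∀ k, Real.circleAverage (fun ζ ↦ ζ / (ζ - x k) * h k ζ) 0 1 = h k (x k) := fun k ↦ by
    have := DiffContOnCl.circleAverage_smul_div (f := h k) (c := 0) (R := 1) (w := x k)
      (by simpa using hh k) (by simpa using hx k)
    simpa using this
  have hsum := Real.circleAverage_fun_sum (s := t) fun k _ ↦ hint k
  simp only [havg] at hsum
  rw [← hsum]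
  have hcomm := Complex.reCLM.circleAverage_comp_comm
    (CircleIntegrable.fun_sum t fun k _ ↦ hint k)
  rw [Complex.reCLM_apply] at hcomm
  rw [← hcomm]
  exact Real.circleAverage_nonneg_of_nonneg fun ζ hζ ↦ hpos ζ (by simpa using hζ)

/-- The de Branges–Rovnyak kernel of `M` is positive semidefinite, in coordinates. -/
def PickNonneg {n : Type*} [Fintype n] (M : ℂ → Matrix n n ℂ) : Prop :=
  ∀ (s : Finset (Metric.ball (0 : ℂ) 1)) (w : Metric.ball (0 : ℂ) 1 → n → ℂ),
    0 ≤ (∑ y ∈ s, ∑ x ∈ s, (1 - conj (x : ℂ) * y)⁻¹ *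
      ∑ i, (w y i * conj (w x i) - (M y *ᵥ w y) i * conj ((M x *ᵥ w x) i))).re

theorem pickNonneg_of_contraction {n : Type*} [Fintype n] {M : ℂ → Matrix n n ℂ}
    (hM : ∀ i j, DiffContOnCl ℂ (fun z ↦ M z i j) (Metric.ball 0 1))
    (hc : ∀ ζ ∈ Metric.sphere (0 : ℂ) 1, ∀ v : n → ℂ,
      ∑ i, ‖((M ζ)ᵀ *ᵥ v) i‖ ^ 2 ≤ ∑ i, ‖v i‖ ^ 2) :
    PickNonneg M := by
  intro s w
  set p : (Metric.ball (0 : ℂ) 1 → n → ℂ) → n → ℂ → ℂ := fun u i ζ ↦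
    ∑ x ∈ s, conj (u x i) * (1 - conj (x : ℂ) * ζ)⁻¹ with hp
  have hpd : ∀ u i, DiffContOnCl ℂ (p u i) (Metric.ball 0 1) := fun u i ↦ by
    refine DifferentiableOn.diffContOnCl fun ζ hζ ↦ DifferentiableAt.differentiableWithinAt ?_
    rw [closure_ball _ one_ne_zero, mem_closedBall_zero_iff] at hζ
    refine DifferentiableAt.fun_sum fun x _ ↦ DifferentiableAt.const_mul
      (DifferentiableAt.fun_inv (by fun_prop) ?_) _
    exact one_sub_conj_mul_ne_zero (mem_ball_zero_iff.1 x.2) hζ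
  set Mw : Metric.ball (0 : ℂ) 1 → n → ℂ := fun x ↦ M x *ᵥ w x with hMw
  have hconj : ∀ ζ ∈ Metric.sphere (0 : ℂ) 1, ∀ u i,
      ∑ y ∈ s, ζ / (ζ - y) * u y i = conj (p u i ζ) := by
    intro ζ hζ u i
    have h₁ : ζ * conj ζ = 1 := by
      rw [Complex.mul_conj, Complex.normSq_eq_norm_sq, mem_sphere_zero_iff_norm.1 hζ]; simp
    have h₀ : ζ ≠ 0 := by rintro rfl; simp at h₁
    simp only [hp, map_sum, map_mul, map_inv₀, map_sub, map_one, Complex.conj_conj]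
    refine Finset.sum_congr rfl fun y _ ↦ ?_
    have h₂ : ζ - y = ζ * (1 - y * conj ζ) := by linear_combination (y : ℂ) * h₁
    rw [h₂, div_mul_cancel_left₀ h₀, mul_comm]
  have key := DiffContOnCl.re_sum_nonneg (Finset.univ ×ˢ s)
    (x := fun k : n × Metric.ball (0 : ℂ) 1 ↦ (k.2 : ℂ)) (fun k ↦ k.2.2)
    (h := fun k ζ ↦ w k.2 k.1 * (p w k.1 ζ - 2 * ∑ j, M ζ j k.1 * p Mw j ζ) +
      Mw k.2 k.1 * p Mw k.1 ζ) ?_ ?_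
  · refine key.trans_eq (congrArg Complex.re ?_)
    rw [Finset.sum_product, Finset.sum_comm]
    refine Finset.sum_congr rfl fun y _ ↦ ?_
    have h₁ : ∑ i, w y i * ∑ j, M y j i * p Mw j y = ∑ j, Mw y j * p Mw j y := by
      simp only [hMw, Matrix.mulVec, dotProduct, Finset.mul_sum, Finset.sum_mul]
      rw [Finset.sum_comm]
      exact Finset.sum_congr rfl fun j _ ↦ Finset.sum_congr rfl fun i _ ↦ by ring
    calc _ = ∑ i, w y i * p w i y - 2 * ∑ i, w y i * ∑ j, M y j i * p Mw j y +
          ∑ i, Mw y i * p Mw i y := by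
          rw [Finset.mul_sum, ← Finset.sum_sub_distrib, ← Finset.sum_add_distrib]
          exact Finset.sum_congr rfl fun i _ ↦ by ring
      _ = ∑ i, (w y i * p w i y - Mw y i * p Mw i y) := by
          rw [h₁, Finset.sum_sub_distrib]; ring
      _ = _ := by
          simp only [hp, Finset.mul_sum, ← Finset.sum_sub_distrib]
          rw [Finset.sum_comm]
          exact Finset.sum_congr rfl fun x _ ↦ Finset.sum_congr rfl fun i _ ↦ by ring
  · intro k
    simp only [← smul_eq_mul]
    have hs : DiffContOnCl ℂ (fun ζ ↦ ∑ j, M ζ j k.1 • p Mw j ζ) (Metric.ball 0 1) :=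
      ⟨DifferentiableOn.fun_sum fun j _ ↦ ((hM j k.1).smul (hpd Mw j)).1,
        continuousOn_finsetSum _ fun j _ ↦ ((hM j k.1).smul (hpd Mw j)).2⟩
    exact (((hpd w k.1).sub (hs.const_smul (2 : ℂ))).const_smul (w k.2 k.1)).add
      ((hpd Mw k.1).const_smul (Mw k.2 k.1))
  · intro ζ hζ
    set g : n → ℂ := (M ζ)ᵀ *ᵥ fun j ↦ p Mw j ζ with hg
    have h₁ : ∑ k ∈ Finset.univ ×ˢ s, ζ / (ζ - k.2) *
        (w k.2 k.1 * (p w k.1 ζ - 2 * ∑ j, M ζ j k.1 * p Mw j ζ) + Mw k.2 k.1 * p Mw k.1 ζ) =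
        ∑ i, (conj (p w i ζ) * (p w i ζ - 2 * g i) + conj (p Mw i ζ) * p Mw i ζ) := by
      rw [Finset.sum_product]
      refine Finset.sum_congr rfl fun i _ ↦ ?_
      rw [← hconj ζ hζ, ← hconj ζ hζ, Finset.sum_mul, Finset.sum_mul, ← Finset.sum_add_distrib]
      refine Finset.sum_congr rfl fun y _ ↦ ?_
      simp only [hg, Matrix.mulVec, dotProduct, Matrix.transpose_apply]
      ring
    rw [h₁, Complex.re_sum]
    have h₂ : ∀ i, (conj (p w i ζ) * (p w i ζ - 2 * g i) + conj (p Mw i ζ) * p Mw i ζ).re =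
        ‖p w i ζ - g i‖ ^ 2 + (‖p Mw i ζ‖ ^ 2 - ‖g i‖ ^ 2) := fun i ↦ by
      simp only [← Complex.normSq_eq_norm_sq, Complex.normSq_apply, Complex.add_re, Complex.mul_re,
        Complex.sub_re, Complex.sub_im, Complex.conj_re, Complex.conj_im, Complex.mul_im,
        Complex.re_ofNat, Complex.im_ofNat]
      ring
    simp only [h₂, Finset.sum_add_distrib, Finset.sum_sub_distrib]
    have h₃ := hc ζ hζ fun j ↦ p Mw j ζ
    have h₄ : 0 ≤ ∑ i, ‖p w i ζ - g i‖ ^ 2 := by positivity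
    linarith

open scoped ComplexOrder in
theorem PickNonneg.posSemidef {n : Type*} [Fintype n] [DecidableEq n] {M : ℂ → Matrix n n ℂ}
    (hM : PickNonneg M) :
    (pickKernel fun z ↦ Matrix.toEuclideanCLM (n := n) (𝕜 := ℂ) (M z)).PosSemidef := by
  have tfae := RKHS.posSemidef_tfae
    (K := pickKernel fun z ↦ Matrix.toEuclideanCLM (n := n) (𝕜 := ℂ) (M z))
  have hiff := tfae.out 0 2
  refine hiff.mpr ⟨?_, fun vv ↦ ?_⟩
  · refine Matrix.IsHermitian.ext fun x y ↦ ?_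
    refine ContinuousLinearMap.ext fun v ↦ ext_inner_right ℂ fun w ↦ ?_
    rw [star_eq_adjoint, adjoint_inner_left, ← inner_conj_symm, inner_pickKernel, inner_pickKernel]
    simp [mul_comm]
  · have h := hM vv.support fun x ↦ WithLp.ofLp (vv x)
    refine h.trans_eq ?_
    rw [Finset.sum_comm, Finsupp.sum]
    simp only [Finsupp.sum, inner_pickKernel]
    refine congrArg Complex.re (Finset.sum_congr rfl fun x _ ↦ Finset.sum_congr rfl fun y _ ↦ ?_)
    simp [PiLp.inner_apply, RCLike.inner_apply, Finset.sum_sub_distrib]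

theorem swap_mem_closedTetra {a b c : ℂ} (h : (a, b, c) ∈ closedTetra) :
    (b, a, c) ∈ closedTetra := fun z hz w hw ↦ by
  have := h w hw z hz
  contrapose! this
  linear_combination this

theorem norm_fst_le_one_of_mem_closedTetra {a b c : ℂ} (h : (a, b, c) ∈ closedTetra) :
    ‖a‖ ≤ 1 := by
  by_contra! ha
  have ha0 : a ≠ 0 := norm_pos_iff.mp (one_pos.trans ha)
  refine h a⁻¹ ?_ 0 (by simp) ?_
  · simpa using inv_lt_one_of_one_lt₀ ha
  · simp [ha0]

theorem norm_sub_mul_le_of_mem_closedTetra {a b c z : ℂ} (h : (a, b, c) ∈ closedTetra)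
    (hz : ‖z‖ ≤ 1) : ‖b - c * z‖ ≤ ‖1 - a * z‖ := by
  have hball : ∀ z ∈ ball (0 : ℂ) 1, ‖b - c * z‖ ≤ ‖1 - a * z‖ := fun z hz ↦ by
    by_contra! hlt
    have h0 : b - c * z ≠ 0 := norm_pos_iff.mp ((norm_nonneg _).trans_lt hlt)
    refine h z hz ((1 - a * z) / (b - c * z)) ?_ ?_
    · rw [mem_ball_zero_iff, norm_div, div_lt_one (norm_pos_iff.mpr h0)]
      exact hlt
    · linear_combination - div_mul_cancel₀ (1 - a * z) h0
  have hcl : closure (ball (0 : ℂ) 1) ⊆ {z | ‖b - c * z‖ ≤ ‖1 - a * z‖} :=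
    closure_minimal hball (isClosed_le (by fun_prop) (by fun_prop))
  rw [closure_ball _ one_ne_zero] at hcl
  exact hcl (mem_closedBall_zero_iff.mpr hz)

theorem two_mul_norm_sub_conj_mul_le_of_mem_closedTetra {a b c : ℂ}
    (h : (a, b, c) ∈ closedTetra) :
    2 * ‖a - conj b * c‖ ≤ 1 + ‖a‖ ^ 2 - ‖b‖ ^ 2 - ‖c‖ ^ 2 := by
  obtain ⟨u, hu, hu'⟩ := Complex.exists_norm_eq_mul_self (a - conj b * c)
  have h1 := pow_le_pow_left₀ (norm_nonneg _) (norm_sub_mul_le_of_mem_closedTetra h hu.le) 2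
  have hu2 : u.re * u.re + u.im * u.im = 1 := by
    rw [← Complex.normSq_apply, Complex.normSq_eq_norm_sq, hu, one_pow]
  have hre := congrArg Complex.re hu'
  simp only [← Complex.normSq_eq_norm_sq, Complex.normSq_apply] at h1 ⊢
  simp only [Complex.ofReal_re] at hre
  rw [hre]
  simp only [Complex.sub_re, Complex.sub_im, Complex.mul_re, Complex.mul_im, Complex.conj_re,
    Complex.conj_im, Complex.one_re, Complex.one_im] at h1 ⊢
  linear_combination h1 + (a.re ^ 2 + a.im ^ 2 - c.re ^ 2 - c.im ^ 2) * hu2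

theorem two_mul_norm_mul_sub_le_of_mem_closedTetra {a b c : ℂ} (h : (a, b, c) ∈ closedTetra) :
    2 * ‖a * b - c‖ ≤ 1 - ‖a‖ ^ 2 - ‖b‖ ^ 2 + ‖c‖ ^ 2 := by
  have h1 := two_mul_norm_sub_conj_mul_le_of_mem_closedTetra h
  have ha := norm_fst_le_one_of_mem_closedTetra h
  have hb := norm_fst_le_one_of_mem_closedTetra (swap_mem_closedTetra h)
  have hid : ‖a - conj b * c‖ ^ 2 - ‖a * b - c‖ ^ 2
      = (‖a‖ ^ 2 - ‖c‖ ^ 2) * (1 - ‖b‖ ^ 2) := by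
    simp only [← Complex.normSq_eq_norm_sq, Complex.normSq_apply]
    simp only [Complex.sub_re, Complex.sub_im, Complex.mul_re, Complex.mul_im, Complex.conj_re,
      Complex.conj_im]
    ring
  have h2 : ‖a‖ - ‖b‖ * ‖c‖ ≤ ‖a - conj b * c‖ := by
    simpa using norm_sub_norm_le a (conj b * c)
  have hs := norm_nonneg a
  have ht := norm_nonneg b
  have hr := norm_nonneg c
  have hd := norm_nonneg (a - conj b * c)
  generalize ‖a‖ = s at *
  generalize ‖b‖ = t at *
  generalize ‖c‖ = r at *
  generalize ‖a - conj b * c‖ = d at *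
  have hsgn : 0 ≤ 1 - s ^ 2 - t ^ 2 + r ^ 2 := by
    have h3 : t - r ≤ 1 - s := (abs_le_of_sq_le_sq' (by nlinarith) (by linarith)).2
    rcases le_total 1 (s + t) with h4 | h4
    · nlinarith [mul_nonneg (sub_nonneg.2 ha) (sub_nonneg.2 hb)]
    · nlinarith
  refine (abs_le_of_sq_le_sq' ?_ hsgn).2
  nlinarith [pow_le_pow_left₀ (by positivity) h1 2]

/-- Completing a diagonal `a, b` with entries `f, g` of equal modulus to a contraction. -/
theorem norm_sq_add_norm_sq_le_of_mem_closedTetra {a b c f g : ℂ}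
    (h : (a, b, c) ∈ closedTetra) (hfg : f * g = a * b - c) (hn : ‖f‖ = ‖g‖) (p q : ℂ) :
    ‖a * p + g * q‖ ^ 2 + ‖f * p + b * q‖ ^ 2 ≤ ‖p‖ ^ 2 + ‖q‖ ^ 2 := by
  have h1 := two_mul_norm_sub_conj_mul_le_of_mem_closedTetra h
  have h2 := two_mul_norm_sub_conj_mul_le_of_mem_closedTetra (swap_mem_closedTetra h)
  have h3 := two_mul_norm_mul_sub_le_of_mem_closedTetra h
  have hd1 := norm_nonneg (a - conj b * c)
  have hd2 := norm_nonneg (b - conj a * c)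
  have hm : ‖a * b - c‖ = ‖g‖ ^ 2 := by rw [← hfg, norm_mul, hn, sq]
  set W := conj a * g + conj f * b with hW
  set X := 1 - ‖a‖ ^ 2 - ‖g‖ ^ 2 with hX
  set Y := 1 - ‖b‖ ^ 2 - ‖g‖ ^ 2 with hY
  have hX0 : 0 ≤ X := by linarith
  have hY0 : 0 ≤ Y := by linarith
  have hW2 : ‖W‖ ^ 2 ≤ X * Y := by
    have hc : c = a * b - f * g := by rw [hfg]; ring
    have : X * Y - ‖W‖ ^ 2 = 1 - ‖a‖ ^ 2 - ‖b‖ ^ 2 + ‖c‖ ^ 2 - 2 * ‖g‖ ^ 2 := by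
      have hn2 : ‖f‖ ^ 2 = ‖g‖ ^ 2 := by rw [hn]
      rw [hX, hY, hW, hc]
      simp only [← Complex.normSq_eq_norm_sq, Complex.normSq_apply] at hn2 ⊢
      simp only [Complex.sub_re, Complex.sub_im, Complex.add_re, Complex.add_im, Complex.mul_re,
        Complex.mul_im, Complex.conj_re, Complex.conj_im]
      linear_combination (-(g.re * g.re + g.im * g.im) - (b.re * b.re + b.im * b.im)) * hn2
    linarith
  have hexp : ‖p‖ ^ 2 + ‖q‖ ^ 2 - (‖a * p + g * q‖ ^ 2 + ‖f * p + b * q‖ ^ 2)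
      = X * ‖p‖ ^ 2 + Y * ‖q‖ ^ 2 - 2 * (W * conj p * q).re := by
    have hn2 : ‖f‖ ^ 2 = ‖g‖ ^ 2 := by rw [hn]
    rw [hX, hY, hW]
    simp only [← Complex.normSq_eq_norm_sq, Complex.normSq_apply] at hn2 ⊢
    simp only [Complex.add_re, Complex.add_im, Complex.mul_re,
        Complex.mul_im, Complex.conj_re, Complex.conj_im]
    linear_combination (-(p.re * p.re + p.im * p.im)) * hn2
  have hre : (W * conj p * q).re ≤ ‖W‖ * ‖p‖ * ‖q‖ := by
    simpa using Complex.re_le_norm (W * conj p * q)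
  have hWs : ‖W‖ ≤ √X * √Y := by
    rw [← Real.sqrt_mul hX0]
    exact Real.le_sqrt_of_sq_le hW2
  have h5 : ‖W‖ * ‖p‖ * ‖q‖ ≤ √X * √Y * ‖p‖ * ‖q‖ := by gcongr
  have h6 := sq_nonneg (√X * ‖p‖ - √Y * ‖q‖)
  rw [sub_sq, mul_pow, mul_pow, Real.sq_sqrt hX0, Real.sq_sqrt hY0] at h6
  linarith

theorem mem_closedTetra_of_norm_sub_le {a b c P : ℂ} {s : ℝ} (h : (a, b, c) ∈ closedTetra)
    (hs0 : 0 ≤ s) (hs1 : s < 1) (hP : ‖P - s ^ 2 * (a * b - c)‖ ≤ (1 - s) ^ 2) :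
    (s * a, s * b, s ^ 2 * (a * b) - P) ∈ closedTetra := fun z hz w hw h0 ↦ by
  rw [mem_ball_zero_iff] at hz hw
  dsimp only at h0
  have ha := norm_fst_le_one_of_mem_closedTetra h
  have hsn : ‖(s : ℂ)‖ = s := by simp [abs_of_nonneg hs0]
  have hsz : ‖(s * z : ℂ)‖ ≤ s := by
    rw [norm_mul, hsn]; exact mul_le_of_le_one_right hs0 hz.le
  have h1 := norm_sub_mul_le_of_mem_closedTetra (z := s * z) h (hsz.trans hs1.le)
  have h2 : 1 - s ≤ ‖1 - a * (s * z)‖ := by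
    have := norm_sub_norm_le 1 (a * (s * z))
    rw [norm_one, norm_mul] at this
    have := mul_le_of_le_one_left (norm_nonneg (s * z : ℂ)) ha
    linarith
  have h3 : 1 - a * (s * z) - s * w * (b - c * (s * z)) = (P - s ^ 2 * (a * b - c)) * z * w := by
    linear_combination h0
  have h4 := norm_sub_norm_le (1 - a * (s * z)) (s * w * (b - c * (s * z)))
  rw [h3, norm_mul, norm_mul, norm_mul, norm_mul, hsn] at h4
  have h5 : s * ‖w‖ * ‖b - c * (s * z)‖ ≤ s * 1 * ‖1 - a * (s * z)‖ := by gcongr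
  have h6 : ‖P - s ^ 2 * (a * b - c)‖ * ‖z‖ * ‖w‖ ≤ (1 - s) ^ 2 * ‖z‖ * 1 := by gcongr
  have h7 : (1 - s) ^ 2 * ‖z‖ < (1 - s) ^ 2 * 1 := by
    have : 0 < 1 - s := by linarith
    gcongr
  have h8 : (1 - s) * (1 - s) ≤ (1 - s) * ‖1 - a * (s * z)‖ :=
    mul_le_mul_of_nonneg_left h2 (by linarith)
  linarith

/-- `h` is a product of two functions of the disc algebra whose moduli agree on the circle. -/
def HasBalancedFactorization (h : ℂ → ℂ) : Prop :=
  ∃ f g : ℂ → ℂ, DiffContOnCl ℂ f (ball 0 1) ∧ DiffContOnCl ℂ g (ball 0 1) ∧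
    (∀ z ∈ closedBall 0 1, f z * g z = h z) ∧ ∀ z ∈ sphere 0 1, ‖f z‖ = ‖g z‖

theorem HasBalancedFactorization.mul {h k : ℂ → ℂ} (hh : HasBalancedFactorization h)
    (hk : HasBalancedFactorization k) : HasBalancedFactorization fun z ↦ h z * k z := by
  obtain ⟨f, g, hf, hg, hfg, hn⟩ := hh
  obtain ⟨f', g', hf', hg', hfg', hn'⟩ := hk
  refine ⟨fun z ↦ f z * f' z, fun z ↦ g z * g' z, hf.smul hf', hg.smul hg', fun z hz ↦ ?_,
    fun z hz ↦ ?_⟩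
  · rw [mul_mul_mul_comm, hfg z hz, hfg' z hz]
  · rw [norm_mul, norm_mul, hn z hz, hn' z hz]

theorem exists_diffContOnCl_mul_self {w : ℂ} (hw : ‖w‖ ≤ 1) :
    ∃ f : ℂ → ℂ, DiffContOnCl ℂ f (ball 0 1) ∧ ∀ z, f z * f z = 1 - w * z := by
  have hre : ∀ z : ℂ, (w * z).re ≤ ‖z‖ := fun z ↦
    (Complex.re_le_norm _).trans (by
      rw [norm_mul]; exact mul_le_of_le_one_left (norm_nonneg z) hw)
  refine ⟨fun z ↦ (1 - w * z) ^ ((2 : ℕ) : ℂ)⁻¹, DiffContOnCl.mk_ball ?_ ?_, fun z ↦ ?_⟩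
  · intro z hz
    refine DifferentiableAt.differentiableWithinAt (DifferentiableAt.cpow_const (by fun_prop) ?_)
    have := (hre z).trans_lt (mem_ball_zero_iff.mp hz)
    exact Or.inl (by simpa using this)
  · intro z hz
    have := (hre z).trans (mem_closedBall_zero_iff.mp hz)
    refine ContinuousAt.continuousWithinAt (ContinuousAt.comp (g := fun u : ℂ ↦ u ^ ((2 : ℕ) : ℂ)⁻¹)
      (Complex.continuousAt_cpow_const_of_re_pos (Or.inl ?_) (by norm_num)) (by fun_prop))
    simpa using this
  · rw [← sq, Complex.cpow_nat_inv_pow _ two_ne_zero]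

theorem hasBalancedFactorization_const (c : ℂ) : HasBalancedFactorization fun _ ↦ c :=
  ⟨fun _ ↦ c ^ ((2 : ℕ) : ℂ)⁻¹, fun _ ↦ c ^ ((2 : ℕ) : ℂ)⁻¹, diffContOnCl_const,
    diffContOnCl_const, fun z _ ↦ by rw [← sq, Complex.cpow_nat_inv_pow _ two_ne_zero],
    fun _ _ ↦ rfl⟩

theorem hasBalancedFactorization_sub_const (r : ℂ) : HasBalancedFactorization fun z ↦ z - r := by
  rcases lt_or_ge ‖r‖ 1 with hr | hr
  · obtain ⟨g, hg, hgg⟩ := exists_diffContOnCl_mul_self (w := conj r) (by simpa using hr.le)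
    have hne : ∀ z ∈ closedBall (0 : ℂ) 1, 1 - conj r * z ≠ 0 := fun z hz ↦
      one_sub_conj_mul_ne_zero hr (mem_closedBall_zero_iff.mp hz)
    have hden : DiffContOnCl ℂ (fun z ↦ (1 - conj r * z)⁻¹) (ball 0 1) :=
      (Differentiable.diffContOnCl (by fun_prop)).inv fun z hz ↦
        hne z (by rwa [closure_ball _ one_ne_zero] at hz)
    have hnum : DiffContOnCl ℂ (fun z ↦ z - r) (ball 0 1) :=
      Differentiable.diffContOnCl (by fun_prop)
    refine ⟨fun z ↦ ((z - r) * (1 - conj r * z)⁻¹) * g z, g, (hnum.smul hden).smul hg, hg,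
      fun z hz ↦ ?_, fun z hz ↦ ?_⟩
    · rw [mul_assoc, hgg, mul_assoc, inv_mul_cancel₀ (hne z hz), mul_one]
    · have hz1 := mem_sphere_zero_iff_norm.mp hz
      have hzz : z * conj z = 1 := by
        rw [Complex.mul_conj, Complex.normSq_eq_norm_sq, hz1]; simp
      have hkey : ‖1 - conj r * z‖ = ‖z - r‖ := by
        rw [show 1 - conj r * z = z * conj (z - r) by rw [map_sub]; linear_combination -hzz,
          norm_mul, hz1, one_mul, Complex.norm_conj]
      have h0 := norm_ne_zero_iff.mpr (hne z (sphere_subset_closedBall hz))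
      rw [norm_mul, norm_mul, norm_inv, ← hkey, mul_inv_cancel₀ h0, one_mul]
  · have hr0 : r ≠ 0 := norm_pos_iff.mp (one_pos.trans_le hr)
    obtain ⟨g, hg, hgg⟩ := exists_diffContOnCl_mul_self (w := r⁻¹)
      (by simpa using inv_le_one_of_one_le₀ hr)
    have h := (hasBalancedFactorization_const (-r)).mul
      (k := fun z ↦ 1 - r⁻¹ * z) ⟨g, g, hg, hg, fun z _ ↦ hgg z, fun _ _ ↦ rfl⟩
    convert h using 2 with z
    field_simp
    ring

theorem Polynomial.hasBalancedFactorization_eval (P : Polynomial ℂ) :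
    HasBalancedFactorization fun z ↦ P.eval z := by
  rw [(IsAlgClosed.splits P).eq_prod_roots]
  simp only [eval_mul, eval_C]
  refine (hasBalancedFactorization_const _).mul ?_
  induction P.roots using Multiset.induction with
  | empty => simpa using hasBalancedFactorization_const 1
  | cons r s ih => simpa using (hasBalancedFactorization_sub_const r).mul ih

theorem DifferentiableOn.exists_polynomial_norm_sub_lt {h : ℂ → ℂ}
    (hh : DifferentiableOn ℂ h (ball 0 1)) {s : ℝ} (hs : s < 1) {ε : ℝ} (hε : 0 < ε) :
    ∃ P : Polynomial ℂ, ∀ z ∈ closedBall (0 : ℂ) s, ‖P.eval z - h z‖ < ε := by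
  obtain ⟨r, hr, hr1⟩ := exists_between (max_lt hs zero_lt_one)
  obtain ⟨R, hR, hR1⟩ := exists_between hr1
  have hr0 : 0 < r := (le_max_right _ _).trans_lt hr
  lift r to NNReal using hr0.le
  lift R to NNReal using (hr0.trans hR).le
  have hp := (hh.mono (closedBall_subset_ball hR1)).hasFPowerSeriesOnBall
    (by exact_mod_cast hr0.trans hR)
  have hu := hp.tendstoUniformlyOn (r' := r) (by exact_mod_cast hR)
  rw [Metric.tendstoUniformlyOn_iff] at hu
  obtain ⟨n, hn⟩ := (hu ε hε).exists
  refine ⟨∑ k ∈ Finset.range n, Polynomial.C ((cauchyPowerSeries h 0 R).coeff k) * Polynomial.X ^ k,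
    fun z hz ↦ ?_⟩
  have := hn z (closedBall_subset_ball ((le_max_left _ _).trans_lt hr) hz)
  rw [zero_add, dist_comm, dist_eq_norm] at this
  have heval : (∑ k ∈ Finset.range n,
      Polynomial.C ((cauchyPowerSeries h 0 R).coeff k) * Polynomial.X ^ k).eval z
      = (cauchyPowerSeries h 0 R).partialSum n z := by
    rw [Polynomial.eval_finsetSum, FormalMultilinearSeries.partialSum]
    refine Finset.sum_congr rfl fun k _ ↦ ?_
    rw [FormalMultilinearSeries.apply_eq_pow_smul_coeff, smul_eq_mul, Polynomial.eval_mul,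
      Polynomial.eval_C, Polynomial.eval_pow, Polynomial.eval_X, mul_comm]
  rwa [heval]

theorem PickNonneg.norm_apply_le {n : Type*} [Fintype n] {M : ℂ → Matrix n n ℂ}
    (hM : PickNonneg M) {z : ℂ} (hz : z ∈ ball (0 : ℂ) 1) (i j : n) : ‖M z i j‖ ≤ 1 := by
  classical
  have h := hM {⟨z, hz⟩} fun _ ↦ Pi.single j 1
  simp only [Finset.sum_singleton, Matrix.mulVec_single_one, Matrix.col_apply,
    Complex.mul_conj, Complex.conj_mul', Complex.normSq_eq_norm_sq] at h
  have hz1 : ‖z‖ ^ 2 < 1 := by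
    rw [sq_lt_one_iff₀ (norm_nonneg z)]; exact mem_ball_zero_iff.mp hz
  have hsum : ∑ i, ‖(Pi.single j 1 : n → ℂ) i‖ ^ 2 = 1 := by
    rw [Finset.sum_eq_single j (fun i _ hi ↦ by simp [hi]) (by simp)]
    simp
  norm_cast at h
  rw [Finset.sum_sub_distrib, hsum] at h
  have h1 := nonneg_of_mul_nonneg_right h (inv_pos.mpr (sub_pos.mpr hz1))
  have h2 := Finset.single_le_sum (f := fun i ↦ ‖M z i j‖ ^ 2) (fun i _ ↦ by positivity)
    (Finset.mem_univ i)
  rw [← sq_le_one_iff₀ (norm_nonneg _)]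
  linarith

theorem PickNonneg.of_tendsto {n κ : Type*} [Fintype n] {l : Filter κ} [l.NeBot]
    {M : κ → ℂ → Matrix n n ℂ} {L : ℂ → Matrix n n ℂ} (hM : ∀ k, PickNonneg (M k))
    (hL : ∀ z ∈ ball (0 : ℂ) 1, ∀ i j, Tendsto (fun k ↦ M k z i j) l (𝓝 (L z i j))) :
    PickNonneg L := fun s w ↦ by
  have hv : ∀ (z : ball (0 : ℂ) 1) (v : n → ℂ) (i : n),
      Tendsto (fun k ↦ (M k z *ᵥ v) i) l (𝓝 ((L z *ᵥ v) i)) := fun z v i ↦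
    tendsto_finsetSum _ fun j _ ↦ (hL z z.2 i j).mul_const _
  refine ge_of_tendsto' ((Complex.continuous_re.tendsto _).comp
    (tendsto_finsetSum s fun y _ ↦ tendsto_finsetSum s fun x _ ↦ Tendsto.const_mul _
      (tendsto_finsetSum _ fun i _ ↦ tendsto_const_nhds.sub
        ((hv y _ i).mul ((Complex.continuous_conj.tendsto _).comp (hv x _ i))))))
    fun k ↦ hM k s w

theorem exists_pickNonneg_tendsto {n κ : Type*} [Fintype n] (l : Ultrafilter κ)
    {M : κ → ℂ → Matrix n n ℂ} (hM : ∀ k, PickNonneg (M k)) :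
    ∃ L : ℂ → Matrix n n ℂ, PickNonneg L ∧
      ∀ z ∈ ball (0 : ℂ) 1, ∀ i j, Tendsto (fun k ↦ M k z i j) l (𝓝 (L z i j)) := by
  have hex : ∀ z i j, ∃ c, z ∈ ball (0 : ℂ) 1 → Tendsto (fun k ↦ M k z i j) l (𝓝 c) := by
    intro z i j
    by_cases hz : z ∈ ball (0 : ℂ) 1
    · obtain ⟨c, -, hc⟩ := (isCompact_closedBall (0 : ℂ) 1).ultrafilter_le_nhds'
        (l.map fun k ↦ M k z i j) (Ultrafilter.mem_map.mpr <| univ_mem' fun k ↦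
          mem_closedBall_zero_iff.mpr ((hM k).norm_apply_le hz i j))
      exact ⟨c, fun _ ↦ hc⟩
    · exact ⟨0, fun h ↦ absurd h hz⟩
  choose L hL using hex
  exact ⟨L, .of_tendsto hM fun z hz i j ↦ hL z i j hz, fun z hz i j ↦ hL z i j hz⟩

/-- Near the map `z ↦ x (s z)` there is a Schur class matrix function regular up to the circle. -/
theorem exists_pickNonneg_norm_sub_le {x₁ x₂ x₃ : ℂ → ℂ} (h₁ : DifferentiableOn ℂ x₁ (ball 0 1))
    (h₂ : DifferentiableOn ℂ x₂ (ball 0 1)) (h₃ : DifferentiableOn ℂ x₃ (ball 0 1))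
    (hxE : ∀ z ∈ ball (0 : ℂ) 1, (x₁ z, x₂ z, x₃ z) ∈ closedTetra) {s : ℝ} (hs0 : 0 < s)
    (hs1 : s < 1) :
    ∃ M : ℂ → Matrix (Fin 2) (Fin 2) ℂ, PickNonneg M ∧ ∀ z ∈ ball (0 : ℂ) 1,
      M z 0 0 = s * x₁ (s * z) ∧ M z 1 1 = s * x₂ (s * z) ∧
      ‖M z 0 1 * M z 1 0 - s ^ 2 * (x₁ (s * z) * x₂ (s * z) - x₃ (s * z))‖ ≤ (1 - s) ^ 2 := by
  have hsn : ‖(s : ℂ)‖ = s := by simp [abs_of_pos hs0]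
  have hsz : ∀ z ∈ closedBall (0 : ℂ) 1, (s : ℂ) * z ∈ closedBall (0 : ℂ) s := fun z hz ↦ by
    rw [mem_closedBall_zero_iff] at hz ⊢
    rw [norm_mul, hsn]
    exact mul_le_of_le_one_right hs0.le hz
  have hsz1 : ∀ z ∈ closedBall (0 : ℂ) 1, (s : ℂ) * z ∈ ball (0 : ℂ) 1 := fun z hz ↦
    closedBall_subset_ball hs1 (hsz z hz)
  obtain ⟨Q, hQ⟩ := ((h₁.mul h₂).sub h₃).exists_polynomial_norm_sub_lt hs1
    (show 0 < (1 - s) ^ 2 by have := sub_pos.mpr hs1; positivity)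
  obtain ⟨f, g, hf, hg, hfg, hn⟩ := (Polynomial.C ((s : ℂ) ^ 2) *
    Q.comp (Polynomial.C (s : ℂ) * Polynomial.X)).hasBalancedFactorization_eval
  simp only [Polynomial.eval_mul, Polynomial.eval_C, Polynomial.eval_comp,
    Polynomial.eval_X] at hfg
  have happrox : ∀ z ∈ closedBall (0 : ℂ) 1,
      ‖f z * g z - s ^ 2 * (x₁ (s * z) * x₂ (s * z) - x₃ (s * z))‖ ≤ (1 - s) ^ 2 := fun z hz ↦ by
    rw [hfg z hz, ← mul_sub, norm_mul, norm_pow, hsn]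
    exact (mul_le_of_le_one_left (norm_nonneg _) (pow_le_one₀ hs0.le hs1.le)).trans
      (hQ _ (hsz z hz)).le
  have hscale : ∀ x : ℂ → ℂ, DifferentiableOn ℂ x (ball 0 1) →
      DiffContOnCl ℂ (fun z ↦ s * x (s * z)) (ball 0 1) := fun x hx ↦ by
    refine DifferentiableOn.diffContOnCl ?_
    rw [closure_ball _ one_ne_zero]
    exact (hx.comp (by fun_prop) hsz1).const_mul _
  refine ⟨fun z ↦ !![s * x₁ (s * z), f z; g z, s * x₂ (s * z)],
    pickNonneg_of_contraction ?_ ?_, fun z hz ↦ ⟨by simp, by simp, ?_⟩⟩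
  · intro i j
    fin_cases i <;> fin_cases j
    exacts [hscale _ h₁, hf, hg, hscale _ h₂]
  · intro z hz v
    have hzc := sphere_subset_closedBall hz
    have htetra := mem_closedTetra_of_norm_sub_le (hxE _ (hsz1 z hzc)) hs0.le hs1
      (happrox z hzc)
    have := norm_sq_add_norm_sq_le_of_mem_closedTetra htetra (f := f z) (g := g z) (by ring)
      (hn z hz) (v 0) (v 1)
    simpa [Fin.sum_univ_two, Matrix.mulVec, dotProduct] using this
  · simpa using happrox z (ball_subset_closedBall hz)

/-- An analytic map into the closed tetrablock is `(M₁₁, M₂₂, det M)` for a matrix function `M`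
in the Schur class. -/
theorem exists_pickNonneg_of_closedTetra {x₁ x₂ x₃ : ℂ → ℂ}
    (h₁ : DifferentiableOn ℂ x₁ (ball 0 1))
    (h₂ : DifferentiableOn ℂ x₂ (ball 0 1)) (h₃ : DifferentiableOn ℂ x₃ (ball 0 1))
    (hxE : ∀ z ∈ ball (0 : ℂ) 1, (x₁ z, x₂ z, x₃ z) ∈ closedTetra) :
    ∃ M : ℂ → Matrix (Fin 2) (Fin 2) ℂ, PickNonneg M ∧ ∀ z ∈ ball (0 : ℂ) 1,
      M z 0 0 = x₁ z ∧ M z 1 1 = x₂ z ∧ (M z).det = x₃ z := by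
  obtain ⟨s, -, hs, hlim⟩ := exists_seq_strictMono_tendsto' (zero_lt_one' ℝ)
  choose M hM hM' using fun k ↦ exists_pickNonneg_norm_sub_le h₁ h₂ h₃ hxE (hs k).1 (hs k).2
  obtain ⟨L, hL, hML⟩ := exists_pickNonneg_tendsto (hyperfilter ℕ) hM
  have hle : (hyperfilter ℕ : Filter ℕ) ≤ atTop := Nat.hyperfilter_le_atTop
  have hsl : Tendsto (fun k ↦ (s k : ℂ)) (hyperfilter ℕ) (𝓝 1) := by
    exact_mod_cast (Complex.continuous_ofReal.tendsto 1).comp (hlim.mono_left hle)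
  refine ⟨L, hL, fun z hz ↦ ?_⟩
  have hsz : Tendsto (fun k ↦ (s k : ℂ) * z) (hyperfilter ℕ) (𝓝 z) := by
    simpa using hsl.mul_const z
  have hx : ∀ x : ℂ → ℂ, DifferentiableOn ℂ x (ball 0 1) →
      Tendsto (fun k ↦ x (s k * z)) (hyperfilter ℕ) (𝓝 (x z)) := fun x hx ↦
    ((hx.differentiableAt (isOpen_ball.mem_nhds hz)).continuousAt.tendsto).comp hsz
  have e₁ : L z 0 0 = x₁ z := by
    refine tendsto_nhds_unique (hML z hz 0 0) ?_
    simp_rw [fun k ↦ (hM' k z hz).1]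
    simpa using hsl.mul (hx _ h₁)
  have e₂ : L z 1 1 = x₂ z := by
    refine tendsto_nhds_unique (hML z hz 1 1) ?_
    simp_rw [fun k ↦ (hM' k z hz).2.1]
    simpa using hsl.mul (hx _ h₂)
  have e₃ : L z 0 1 * L z 1 0 = x₁ z * x₂ z - x₃ z := by
    have hb : Tendsto (fun k ↦ (1 - s k) ^ 2) (hyperfilter ℕ) (𝓝 0) := by
      simpa using ((hlim.mono_left hle).const_sub 1).pow 2
    have h0 := squeeze_zero_norm (fun k ↦ (hM' k z hz).2.2) hb
    have h1 := ((hML z hz 0 1).mul (hML z hz 1 0)).sub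
      ((hsl.pow 2).mul (((hx _ h₁).mul (hx _ h₂)).sub (hx _ h₃)))
    have := tendsto_nhds_unique h1 h0
    linear_combination this
  exact ⟨e₁, e₂, by rw [Matrix.det_fin_two, e₁, e₂, e₃]; ring⟩

end

theorem stmt_3 (x₁ x₂ x₃ : ℂ → ℂ)
    (hx : DifferentiableOn ℂ (fun z => ((x₁ z, x₂ z, x₃ z) : ℂ × ℂ × ℂ)) (Metric.ball (0:ℂ) 1))
    (hxE : ∀ z ∈ Metric.ball (0:ℂ) 1, (x₁ z, x₂ z, x₃ z) ∈ closedTetra) :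
    ∃ (H : Type) (_ : NormedAddCommGroup H) (_ : InnerProductSpace ℂ H) (_ : CompleteSpace H)
      (A : H →L[ℂ] H) (B₁ B₂ : ℂ →L[ℂ] H) (C₁ C₂ : H →L[ℂ] ℂ) (D₁₁ D₁₂ D₂₁ D₂₂ : ℂ),
      (∃ U : WithLp 2 (H × EuclideanSpace ℂ (Fin 2)) ≃ₗᵢ[ℂ]
              WithLp 2 (H × EuclideanSpace ℂ (Fin 2)),
        ∀ (h : H) (u : EuclideanSpace ℂ (Fin 2)),
          U ((WithLp.equiv 2 (H × EuclideanSpace ℂ (Fin 2))).symm (h, u)) =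
            (WithLp.equiv 2 (H × EuclideanSpace ℂ (Fin 2))).symm
              (A h + B₁ (u 0) + B₂ (u 1),
                (WithLp.equiv 2 (Fin 2 → ℂ)).symm
                  ![C₁ h + D₁₁ * u 0 + D₁₂ * u 1, C₂ h + D₂₁ * u 0 + D₂₂ * u 1])) ∧
      ∀ l ∈ Metric.ball (0:ℂ) 1,
        IsUnit (1 - l • A) ∧
        x₁ l = D₁₁ + l * C₁ ((Ring.inverse (1 - l • A)) (B₁ 1)) ∧
        x₂ l = D₂₂ + l * C₂ ((Ring.inverse (1 - l • A)) (B₂ 1)) ∧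
        x₃ l = Matrix.det
          !![D₁₁ + l * C₁ ((Ring.inverse (1 - l • A)) (B₁ 1)),
             D₁₂ + l * C₁ ((Ring.inverse (1 - l • A)) (B₂ 1));
             D₂₁ + l * C₂ ((Ring.inverse (1 - l • A)) (B₁ 1)),
             D₂₂ + l * C₂ ((Ring.inverse (1 - l • A)) (B₂ 1))] := by
  obtain ⟨M, hM, hMx⟩ := exists_pickNonneg_of_closedTetra
    (x₁ := x₁) (x₂ := x₂) (x₃ := x₃) hx.fst hx.snd.fst hx.snd.snd hxE
  obtain ⟨H, i₁, i₂, i₃, U, hU⟩ := exists_colligation _ hM.posSemidef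
  obtain ⟨A, B, C, D, hblock, hreal⟩ := exists_blocks _ U hU
  refine ⟨H, i₁, i₂, i₃, A, B 0, B 1, C 0, C 1, D 0 0, D 0 1, D 1 0, D 1 1, ⟨U, hblock⟩,
    fun l hl ↦ ?_⟩
  obtain ⟨hunit, hentry⟩ := hreal l hl
  have hentry' : ∀ i j, D i j + l * C i (Ring.inverse (1 - l • A) (B j 1)) = M l i j :=
    fun i j ↦ by simp [← hentry i j]
  simp only [hentry']
  obtain ⟨h₁, h₂, h₃⟩ := hMx l hl
  exact ⟨hunit, h₁.symm, h₂.symm, by rw [← h₃, ← Matrix.eta_fin_two (M l)]⟩
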